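/- arXiv:2012.07067 — 3 statements merged into one kernel-verified Lean document; each statement's English description precedes it below -/
import Mathlib

section
/- Let p be a prime, let m be an integer with 1 ≤ m ≤ p − 1, and let n ≥ 1. For 0 ≤ l ≤ n−1 set R_l(m) = Σ_{p−1 ≥ m_1 ≥ ⋯ ≥ m_l ≥ m} Π_{j=1}^{l} 1/[m_j] ∈ ℚ(q) (so R_0(m) = 1). Then in ℚ(q): (−1)^{m−1} · q^{m(m−1)/2} · qbinom(p−1, m−1) ≡ (−1)^{p−1} · q^{p(p−1)/2} · Σ_{l=0}^{n−1} [p]^l · R_l(m) (mod [p]^n). -/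
open Finset

/-- `[N] = 1 + q + ⋯ + q^{N-1}` in `ℚ[q]`. -/
noncomputable def qiP (N : ℕ) : Polynomial ℚ := ∑ i ∈ Finset.range N, Polynomial.X ^ i

/-- `[N] = 1 + q + ⋯ + q^{N-1}` in `ℚ(q)`. -/
noncomputable def qiR (N : ℕ) : RatFunc ℚ := ∑ i ∈ Finset.range N, RatFunc.X ^ i

/-- The q-binomial coefficient `qbinom(N, M) = Π_{j=1}^{M} [N−j+1]/[j]` in `ℚ(q)`. -/
noncomputable def qbinomR (N M : ℕ) : RatFunc ℚ :=
  ∏ j ∈ Finset.range M, qiR (N - j) / qiR (j + 1)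

/-- `R_l(m) = Σ_{M ≥ m₁ ≥ ⋯ ≥ m_l ≥ m} Π_j 1/[m_j]` (here `Rsum l M m`, with `R_0 = 1`). -/
noncomputable def Rsum : ℕ → ℕ → ℕ → RatFunc ℚ
  | 0, _, _ => 1
  | l + 1, M, m => ∑ i ∈ Finset.Icc m M, (1 / qiR i) * Rsum l i m

/-- `A ≡ B (mod [p]^n)` in `ℚ(q)`:  `A − B = [p]^n f/g` with `f, g ∈ ℚ[q]`, `[p] ∤ g`. -/
def CongMod (p n : ℕ) (A B : RatFunc ℚ) : Prop :=
  ∃ f g : Polynomial ℚ, ¬ (qiP p ∣ g) ∧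
    A - B = (algebraMap (Polynomial ℚ) (RatFunc ℚ) (qiP p)) ^ n *
      (algebraMap (Polynomial ℚ) (RatFunc ℚ) f / algebraMap (Polynomial ℚ) (RatFunc ℚ) g)

/-- Membership in the localization of `ℚ[q]` at `[p]`. -/
def InLoc (p : ℕ) (A : RatFunc ℚ) : Prop :=
  ∃ f g : Polynomial ℚ, ¬ (qiP p ∣ g) ∧
    A = algebraMap (Polynomial ℚ) (RatFunc ℚ) f / algebraMap (Polynomial ℚ) (RatFunc ℚ) g

lemma qiP_map (N : ℕ) : algebraMap (Polynomial ℚ) (RatFunc ℚ) (qiP N) = qiR N := by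
  simp [qiP, qiR]

lemma qiP_prime {p : ℕ} (hp : p.Prime) : Prime (qiP p) := by
  have := Fact.mk hp
  have h : qiP p = Polynomial.cyclotomic p ℚ := by
    rw [Polynomial.cyclotomic_prime]; rfl
  rw [h]
  exact (Polynomial.cyclotomic.irreducible_rat hp.pos).prime

lemma qiP_mul (N : ℕ) : qiP N * (Polynomial.X - 1) = Polynomial.X ^ N - 1 :=
  geom_sum_mul _ _

lemma qiR_mul (N : ℕ) : qiR N * (RatFunc.X - 1) = RatFunc.X ^ N - 1 :=
  geom_sum_mul _ _

lemma qiP_ne {N : ℕ} (hN : 0 < N) : qiP N ≠ 0 := by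
  intro h
  have := qiP_mul N
  rw [h, zero_mul] at this
  exact Polynomial.X_pow_sub_C_ne_zero (R := ℚ) hN 1 (by simpa using this.symm)

lemma qiR_ne {N : ℕ} (hN : 0 < N) : qiR N ≠ 0 := by
  rw [← qiP_map]
  exact RatFunc.algebraMap_ne_zero (qiP_ne hN)

lemma qiP_natDegree {N : ℕ} (hN : 0 < N) : (qiP N).natDegree + 1 = N := by
  have h := congrArg Polynomial.natDegree (qiP_mul N)
  have h1 : (Polynomial.X - 1 : Polynomial ℚ) ≠ 0 := by
    simpa using Polynomial.X_sub_C_ne_zero (1 : ℚ)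
  rw [Polynomial.natDegree_mul (qiP_ne hN) h1] at h
  have h2 : (Polynomial.X - 1 : Polynomial ℚ).natDegree = 1 := by
    simpa using Polynomial.natDegree_X_sub_C (1 : ℚ)
  have h3 : (Polynomial.X ^ N - 1 : Polynomial ℚ).natDegree = N := by
    simpa using Polynomial.natDegree_X_pow_sub_C (n := N) (r := (1 : ℚ))
  rw [h2, h3] at h
  exact h

lemma qiP_not_dvd {p k : ℕ} (hk : 0 < k) (hkp : k < p) : ¬ qiP p ∣ qiP k := by
  intro h
  have := Polynomial.natDegree_le_of_dvd h (qiP_ne hk)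
  have h1 := qiP_natDegree hk
  have h2 := qiP_natDegree (N := p) (by omega)
  omega

lemma qiP_not_dvd_X {p : ℕ} (hp : p.Prime) (j : ℕ) :
    ¬ qiP p ∣ (Polynomial.X : Polynomial ℚ) ^ j := by
  intro h
  have h1 : qiP p ∣ Polynomial.X ^ p := by
    have := (qiP_prime hp).dvd_of_dvd_pow h
    exact dvd_pow this hp.ne_zero
  have h2 : qiP p ∣ Polynomial.X ^ p - 1 := ⟨_, (qiP_mul p).symm⟩
  have h3 : qiP p ∣ 1 := by simpa using dvd_sub h1 h2
  exact (qiP_prime hp).not_isUnit (isUnit_of_dvd_one h3)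

lemma InLoc.of_poly {p : ℕ} (hp : p.Prime) (f : Polynomial ℚ) :
    InLoc p (algebraMap (Polynomial ℚ) (RatFunc ℚ) f) :=
  ⟨f, 1, fun h => (qiP_prime hp).not_isUnit (isUnit_of_dvd_one h), by simp⟩

lemma ne_of_not_dvd {p : ℕ} {g : Polynomial ℚ} (h : ¬ qiP p ∣ g) :
    algebraMap (Polynomial ℚ) (RatFunc ℚ) g ≠ 0 :=
  RatFunc.algebraMap_ne_zero (fun h0 => h (h0 ▸ dvd_zero _))

lemma InLoc.mul {p : ℕ} (hp : p.Prime) {A B : RatFunc ℚ} (hA : InLoc p A) (hB : InLoc p B) :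
    InLoc p (A * B) := by
  obtain ⟨f, g, h, rfl⟩ := hA
  obtain ⟨f', g', h', rfl⟩ := hB
  refine ⟨f * f', g * g', fun hh => ((qiP_prime hp).dvd_or_dvd hh).elim h h', ?_⟩
  rw [map_mul, map_mul, div_mul_div_comm]

lemma InLoc.add {p : ℕ} (hp : p.Prime) {A B : RatFunc ℚ} (hA : InLoc p A) (hB : InLoc p B) :
    InLoc p (A + B) := by
  obtain ⟨f, g, h, rfl⟩ := hA
  obtain ⟨f', g', h', rfl⟩ := hB
  refine ⟨f * g' + g * f', g * g', fun hh => ((qiP_prime hp).dvd_or_dvd hh).elim h h', ?_⟩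
  rw [div_add_div _ _ (ne_of_not_dvd h) (ne_of_not_dvd h')]
  simp only [map_mul, map_add]

lemma InLoc.one {p : ℕ} (hp : p.Prime) : InLoc p 1 := by
  simpa using InLoc.of_poly hp 1

lemma InLoc.zero {p : ℕ} (hp : p.Prime) : InLoc p 0 := by
  simpa using InLoc.of_poly hp 0

lemma InLoc.inv_qi {p k : ℕ} (hk : 0 < k) (hkp : k < p) : InLoc p (1 / qiR k) :=
  ⟨1, qiP k, qiP_not_dvd hk hkp, by simp [qiP_map]⟩

lemma key {p j : ℕ} (hj : 0 < j) (hjp : j < p) :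
    1 - qiR p / qiR j = - (RatFunc.X ^ j * qiR (p - j)) / qiR j := by
  have h1 := qiR_ne hj
  have hX : (RatFunc.X - 1 : RatFunc ℚ) ≠ 0 := by
    have : qiR 1 * (RatFunc.X - 1 : RatFunc ℚ) = RatFunc.X - 1 := by simp [qiR]
    have h := ne_of_not_dvd (p := 0) (g := Polynomial.X - 1) (by
      have : qiP 0 = 0 := by simp [qiP]
      rw [this, zero_dvd_iff]
      simpa using Polynomial.X_sub_C_ne_zero (1 : ℚ))
    simpa using h
  have h2 : qiR p = qiR j + RatFunc.X ^ j * qiR (p - j) := by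
    apply mul_right_cancel₀ hX
    have e : (RatFunc.X : RatFunc ℚ) ^ p = RatFunc.X ^ j * RatFunc.X ^ (p - j) := by
      rw [← pow_add]; congr 1; omega
    rw [add_mul, mul_assoc, qiR_mul, qiR_mul, qiR_mul, e]
    ring
  rw [h2]
  field_simp
  ring

lemma factor_ne {p j : ℕ} (hj : 0 < j) (hjp : j < p) : 1 - qiR p / qiR j ≠ 0 := by
  rw [key hj hjp]
  exact div_ne_zero (neg_ne_zero.mpr (mul_ne_zero (pow_ne_zero _ RatFunc.X_ne_zero)
    (qiR_ne (by omega)))) (qiR_ne hj)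

lemma InLoc.factor_inv {p j : ℕ} (hp : p.Prime) (hj : 0 < j) (hjp : j < p) :
    InLoc p (1 - qiR p / qiR j)⁻¹ := by
  refine ⟨- qiP j, Polynomial.X ^ j * qiP (p - j), fun hh => ?_, ?_⟩
  · exact ((qiP_prime hp).dvd_or_dvd hh).elim (qiP_not_dvd_X hp j)
      (qiP_not_dvd (by omega) (by omega))
  · rw [key hj hjp, inv_div, map_neg, map_mul, map_pow, qiP_map, qiP_map, RatFunc.algebraMap_X,
      div_neg, neg_div]

/-- The generating product. -/
noncomputable def Gp (p m M : ℕ) : RatFunc ℚ := ∏ j ∈ Icc m M, (1 - qiR p / qiR j)⁻¹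

lemma Gp_loc {p m M : ℕ} (hp : p.Prime) (hm : 1 ≤ m) (hM : M < p) : InLoc p (Gp p m M) := by
  refine Finset.prod_induction _ (InLoc p) (fun _ _ => InLoc.mul hp) (InLoc.one hp) ?_
  intro j hj
  rw [mem_Icc] at hj
  exact InLoc.factor_inv hp (by omega) (by omega)

lemma Gp_rec {p a M : ℕ} (haM : a ≤ M) : M < p →
    Gp p (a + 1) M = 1 + qiR p * ∑ i ∈ Icc (a + 1) M, (1 / qiR i) * Gp p (a + 1) i := by
  induction M, haM using Nat.le_induction with
  | base => intro _; simp [Gp]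
  | succ M h ih =>
    intro hM
    have ih := ih (by omega)
    rw [Finset.sum_Icc_succ_top (by omega), mul_add, ← add_assoc, ← ih]
    have h1 : Gp p (a + 1) (M + 1) = Gp p (a + 1) M * (1 - qiR p / qiR (M + 1))⁻¹ := by
      unfold Gp; rw [Finset.prod_Icc_succ_top (by omega)]
    have h2 := factor_ne (p := p) (j := M + 1) (by omega) hM
    have h3 : Gp p (a + 1) M = Gp p (a + 1) (M + 1) * (1 - qiR p / qiR (M + 1)) := by
      rw [h1, inv_mul_cancel_right₀ h2]
    rw [h3]
    ring

lemma expand {p a : ℕ} (hp : p.Prime) (n : ℕ) : ∀ M, a ≤ M → M < p →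
    ∃ T, InLoc p T ∧ Gp p (a + 1) M - ∑ l ∈ range n, qiR p ^ l * Rsum l M (a + 1)
      = qiR p ^ n * T := by
  induction n with
  | zero => intro M _ hM; exact ⟨Gp p (a + 1) M, Gp_loc hp (by omega) hM, by simp⟩
  | succ n ih =>
    intro M haM hM
    choose! T hT hE using ih
    refine ⟨∑ i ∈ Icc (a + 1) M, (1 / qiR i) * T i, ?_, ?_⟩
    · refine Finset.sum_induction _ (InLoc p) (fun _ _ => InLoc.add hp) (InLoc.zero hp) ?_
      intro i hi
      rw [mem_Icc] at hi
      exact InLoc.mul hp (InLoc.inv_qi (by omega) (by omega)) (hT i (by omega) (by omega))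
    · have e : qiR p ^ (n + 1) * ∑ i ∈ Icc (a + 1) M, (1 / qiR i) * T i
          = qiR p * ∑ i ∈ Icc (a + 1) M, (1 / qiR i) *
            (Gp p (a + 1) i - ∑ l ∈ range n, qiR p ^ l * Rsum l i (a + 1)) := by
        rw [pow_succ', mul_assoc, Finset.mul_sum (a := qiR p ^ n)]
        congr 1
        refine Finset.sum_congr rfl fun i hi => ?_
        rw [mem_Icc] at hi
        rw [hE i (by omega) (by omega)]
        ring
      rw [e, Finset.sum_range_succ', Gp_rec haM hM]
      simp only [mul_sub, Finset.sum_sub_distrib, Rsum, pow_zero, mul_one]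
      have e2 : ∑ l ∈ range n, qiR p ^ (l + 1) * ∑ i ∈ Icc (a + 1) M, 1 / qiR i * Rsum l i (a + 1)
          = qiR p * ∑ i ∈ Icc (a + 1) M,
            1 / qiR i * ∑ l ∈ range n, qiR p ^ l * Rsum l i (a + 1) := by
        simp only [Finset.mul_sum]
        rw [Finset.sum_comm]
        refine Finset.sum_congr rfl fun i _ => Finset.sum_congr rfl fun l _ => ?_
        ring
      rw [e2]
      ring

/-- The left-hand side, with `m = a + 1`. -/
noncomputable def Fp (p a : ℕ) : RatFunc ℚ :=
  (-1 : RatFunc ℚ) ^ a * RatFunc.X ^ ((a + 1) * a / 2) * qbinomR (p - 1) a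

lemma Fp_succ {p a : ℕ} (h : a + 1 < p) :
    Fp p (a + 1) = Fp p a * (1 - qiR p / qiR (a + 1)) := by
  have e : (a + 1 + 1) * (a + 1) / 2 = (a + 1) * a / 2 + (a + 1) := by
    have : (a + 1 + 1) * (a + 1) = (a + 1) * a + (a + 1) * 2 := by ring
    rw [this, Nat.add_mul_div_right _ _ (by norm_num)]
  rw [key (by omega) h]
  unfold Fp qbinomR
  rw [e, Finset.prod_range_succ, show p - 1 - a = p - (a + 1) by omega]
  ring

lemma Fp_eq {p a M : ℕ} (haM : a ≤ M) : M < p → Fp p a = Fp p M * Gp p (a + 1) M := by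
  induction M, haM using Nat.le_induction with
  | base => intro _; simp [Gp]
  | succ M h ih =>
    intro hM
    have h2 := factor_ne (p := p) (j := M + 1) (by omega) hM
    rw [ih (by omega), Fp_succ hM]
    unfold Gp
    rw [Finset.prod_Icc_succ_top (by omega)]
    field_simp

lemma qbinom_self (N : ℕ) : qbinomR N N = 1 := by
  unfold qbinomR
  rw [Finset.prod_div_distrib, ← Finset.prod_range_reflect (fun j => qiR (j + 1))]
  rw [Finset.prod_congr rfl (g := fun j => qiR (N - 1 - j + 1))]
  · apply div_self
    exact Finset.prod_ne_zero_iff.mpr fun j _ => qiR_ne (by omega)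
  · intro j hj
    rw [mem_range] at hj
    congr 1
    omega

theorem stmt17 (p : ℕ) (hp : p.Prime) (m : ℕ) (hm1 : 1 ≤ m) (hmp : m ≤ p - 1)
    (n : ℕ) (hn : 1 ≤ n) :
    CongMod p n
      ((-1 : RatFunc ℚ) ^ (m - 1) * RatFunc.X ^ (m * (m - 1) / 2) * qbinomR (p - 1) (m - 1))
      ((-1 : RatFunc ℚ) ^ (p - 1) * RatFunc.X ^ (p * (p - 1) / 2) *
        ∑ l ∈ Finset.range n, qiR p ^ l * Rsum l (p - 1) m) := by
  obtain ⟨a, rfl⟩ : ∃ a, m = a + 1 := ⟨m - 1, by omega⟩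
  have hp2 := hp.two_le
  have hF : Fp p (p - 1) = (-1 : RatFunc ℚ) ^ (p - 1) * RatFunc.X ^ (p * (p - 1) / 2) := by
    unfold Fp
    rw [qbinom_self, mul_one, show p - 1 + 1 = p by omega]
  obtain ⟨T, hT, hE⟩ := expand (a := a) hp n (p - 1) (by omega) (by omega)
  have hA : (-1 : RatFunc ℚ) ^ (a + 1 - 1) * RatFunc.X ^ ((a + 1) * (a + 1 - 1) / 2) *
      qbinomR (p - 1) (a + 1 - 1) = Fp p (p - 1) * Gp p (a + 1) (p - 1) := by
    rw [← Fp_eq (by omega) (by omega)]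
    rfl
  have hL : InLoc p (Fp p (p - 1) * T) := by
    refine InLoc.mul hp ?_ hT
    rw [hF]
    have h := InLoc.of_poly hp ((-1) ^ (p - 1) * Polynomial.X ^ (p * (p - 1) / 2))
    rwa [map_mul, map_pow, map_pow, map_neg, map_one, RatFunc.algebraMap_X] at h
  obtain ⟨f, g, hg, hfg⟩ := hL
  refine ⟨f, g, hg, ?_⟩
  rw [← hfg, hA, ← hF, ← mul_sub, hE, qiP_map]
  ring
end

section
/- Let m ≥ 2 be an integer and set ζ_m = e^{2πi/m} ∈ ℂ. Then there exists a unique formal power series F ∈ ℂ[[t]] whose constant coefficient is ζ_m and which satisfies Σ_{j=0}^{m−1} F^j = t (the power series t). Moreover, for every l ≥ 0, the coefficient of t^l in F equals ζ_m · Σ_{j=0}^{l} ( (−ζ_m)^j / ((j+1)! · (l−j)!) ) · Π_{i=0}^{l−1} ( −(j+1)/m + i ). -/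
open Finset

namespace Stmt18Aux
open PowerSeries

/-- The vanishing coefficient behind Lagrange inversion. -/
lemma coeff_key (φ : PowerSeries ℂ) (d : ℕ) :
    coeff (d + 1) (φ ^ d * (φ - X * d⁄dX ℂ φ)) = 0 := by
  have h := congrArg (coeff d) (derivative_pow φ (d + 1))
  rw [coeff_derivative] at h
  have e : φ ^ d * (φ - X * d⁄dX ℂ φ) = φ ^ (d + 1) - X * (φ ^ d * d⁄dX ℂ φ) := by ring
  rw [e, map_sub, coeff_succ_X_mul]
  simp only [Nat.add_sub_cancel, mul_assoc] at h
  have h2 : coeff d (((d + 1 : ℕ) : PowerSeries ℂ) * (φ ^ d * d⁄dX ℂ φ))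
      = ((d : ℂ) + 1) * coeff d (φ ^ d * d⁄dX ℂ φ) := by
    rw [← nsmul_eq_mul, map_nsmul, nsmul_eq_mul]; push_cast; ring
  rw [h2, mul_comm] at h
  have h3 : (d : ℂ) + 1 ≠ 0 := by exact_mod_cast Nat.succ_ne_zero d
  rw [mul_left_cancel₀ h3 h, sub_self]

/-- Lagrange inversion formula (second form). -/
lemma lagrange (φ ψ F : PowerSeries ℂ) (hφ : φ * ψ = 1) (n : ℕ) :
    coeff (n + 1) F =
      coeff (n + 1) (F.subst (X * ψ) * (φ ^ n * (φ - X * d⁄dX ℂ φ))) := by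
  have hs : HasSubst (X * ψ : PowerSeries ℂ) :=
    HasSubst.of_constantCoeff_zero' (by simp)
  have hF := eq_X_pow_mul_shift_add_trunc (n + 2) F
  have hF2 := congrArg (PowerSeries.subst (X * ψ)) hF
  rw [subst_add hs, subst_mul hs, subst_pow hs, subst_X hs, subst_coe hs,
    Polynomial.aeval_eq_sum_range' (lt_of_lt_of_eq (natDegree_trunc_lt F (n + 1)) rfl)] at hF2
  rw [hF2, add_mul, map_add, Finset.sum_mul, map_sum]
  have h0 : ∀ R : PowerSeries ℂ, coeff (n + 1) ((X * ψ) ^ (n + 2) * R *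
      (φ ^ n * (φ - X * d⁄dX ℂ φ))) = 0 := by
    intro R
    have : (X * ψ) ^ (n + 2) * R * (φ ^ n * (φ - X * d⁄dX ℂ φ)) =
      X ^ (n + 2) * (ψ ^ (n + 2) * R * (φ ^ n * (φ - X * d⁄dX ℂ φ))) := by ring
    rw [this, coeff_X_pow_mul', if_neg (by omega)]
  rw [h0, zero_add, Finset.sum_range_succ]
  have h1 : ∀ k ∈ Finset.range (n + 1), coeff (n + 1) ((trunc (n + 2) F).coeff k • (X * ψ) ^ k *
      (φ ^ n * (φ - X * d⁄dX ℂ φ))) = 0 := by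
    intro k hk
    obtain ⟨d, rfl⟩ := Nat.exists_eq_add_of_le (Nat.lt_succ_iff.mp (Finset.mem_range.mp hk))
    have : (X * ψ) ^ k * (φ ^ (k + d) * (φ - X * d⁄dX ℂ φ)) =
        X ^ k * (φ ^ d * (φ - X * d⁄dX ℂ φ)) := by
      calc _ = (φ * ψ) ^ k * (X ^ k * (φ ^ d * (φ - X * d⁄dX ℂ φ))) := by ring
        _ = _ := by rw [hφ]; ring
    rw [smul_mul_assoc, this, coeff_smul, show k + d + 1 = d + 1 + k by ring, coeff_X_pow_mul,
      coeff_key, smul_zero]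
  rw [Finset.sum_eq_zero h1, zero_add]
  have h4 : (X * ψ) ^ (n + 1) * (φ ^ n * (φ - X * d⁄dX ℂ φ)) =
      X ^ (n + 1) * (1 - X * (ψ * d⁄dX ℂ φ)) := by
    calc _ = (φ * ψ) ^ n * (X ^ (n + 1) * (φ * ψ - X * (ψ * d⁄dX ℂ φ))) := by ring
      _ = _ := by rw [hφ]; ring
  rw [smul_mul_assoc, h4, coeff_smul, coeff_trunc, if_pos (by omega)]
  have := coeff_X_pow_mul (1 - X * (ψ * d⁄dX ℂ φ)) (n + 1) 0
  rw [zero_add] at this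
  rw [this]
  simp

/-- Uniqueness of the solution. -/
lemma uniq (m : ℕ) (hm : 2 ≤ m) (z : ℂ) (hz : z ≠ 0) (f A B : PowerSeries ℂ)
    (hf : constantCoeff f = 0)
    (hA0 : constantCoeff A = z) (hB0 : constantCoeff B = z)
    (hA : ∑ j ∈ Finset.range m, A ^ j = f) (hB : ∑ j ∈ Finset.range m, B ^ j = f) : A = B := by
  have gA := geom_sum_mul A m
  have gB := geom_sum_mul B m
  rw [hA] at gA
  rw [hB] at gB
  have g := (Commute.all A B).geom_sum₂_mul m
  have key : (∑ i ∈ Finset.range m, A ^ i * B ^ (m - 1 - i) - f) * (A - B) = 0 := by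
    linear_combination g + gB - gA
  rcases mul_eq_zero.mp key with h | h
  · exfalso
    have h' := congrArg constantCoeff h
    simp only [map_sub, map_sum, map_mul, map_pow, hA0, hB0, hf, map_zero, sub_zero] at h'
    rw [Finset.sum_congr rfl (g := fun _ => z ^ (m - 1))] at h'
    · simp at h'
      rcases h' with h' | h'
      · omega
      · exact hz h'.1
    · intro i hi
      rw [← pow_add]
      congr 1
      have := Finset.mem_range.mp hi
      omega
  · exact sub_eq_zero.mp h

lemma binom_pow (a : ℂ) (k : ℕ) :
    (PowerSeries.binomialSeries ℂ a) ^ k = PowerSeries.binomialSeries ℂ ((k : ℂ) * a) := by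
  induction k with
  | zero => simp
  | succ k ih => rw [pow_succ, ih, ← binomialSeries_add]; congr 1; push_cast; ring

lemma choose_prod (a : ℂ) (l : ℕ) :
    Ring.choose a l = (-1) ^ l * (∏ i ∈ Finset.range l, (-a + (i : ℂ))) / (l.factorial : ℂ) := by
  have h := Ring.descPochhammer_eq_factorial_smul_choose a l
  rw [nsmul_eq_mul, ← Polynomial.aeval_eq_smeval, Polynomial.aeval_def,
    ← Polynomial.eval_map, descPochhammer_map,
    descPochhammer_eval_eq_prod_range] at h
  rw [eq_div_iff (by exact_mod_cast l.factorial_ne_zero), mul_comm, ← h]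
  have : (-1 : ℂ) ^ l = ∏ i ∈ Finset.range l, (-1 : ℂ) := by simp
  rw [this, ← Finset.prod_mul_distrib]
  exact Finset.prod_congr rfl fun i _ => by ring

/-- The basic data: `B = z (1+X)^(1/m)` and an inverse of `B - 1`. -/
lemma exists_data (m : ℕ) (hm : 2 ≤ m) (z : ℂ) (hz1 : z ≠ 1) (hzm : z ^ m = 1)
    (B : PowerSeries ℂ) (hBdef : B = C z * PowerSeries.binomialSeries ℂ (1 / (m : ℂ))) :
    constantCoeff B = z ∧ (B - 1) * (B - 1)⁻¹ = 1 ∧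
      ∑ j ∈ Finset.range m, B ^ j = X * (B - 1)⁻¹ := by
  have hB0 : constantCoeff B = z := by simp [hBdef]
  have hc : constantCoeff (B - 1) ≠ 0 := by
    rw [map_sub, hB0, map_one]; exact sub_ne_zero.mpr hz1
  have hinv : (B - 1) * (B - 1)⁻¹ = 1 := PowerSeries.mul_inv_cancel _ hc
  refine ⟨hB0, hinv, ?_⟩
  have hBm : B ^ m = 1 + X := by
    have hm0 : (m : ℂ) ≠ 0 := by exact_mod_cast (by omega : m ≠ 0)
    rw [hBdef, mul_pow, binom_pow, ← map_pow, hzm, map_one, one_mul, mul_one_div_cancel hm0]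
    have := binomialSeries_nat (R := ℂ) (A := ℂ) 1
    simpa using this
  have g := geom_sum_mul B m
  rw [hBm] at g
  linear_combination (B - 1)⁻¹ * g - (∑ j ∈ Finset.range m, B ^ j) * hinv

lemma existence (m : ℕ) (hm : 2 ≤ m) (z : ℂ) (hz1 : z ≠ 1) (hzm : z ^ m = 1) :
    ∃ F : PowerSeries ℂ, constantCoeff F = z ∧ ∑ j ∈ Finset.range m, F ^ j = X := by
  obtain ⟨hB0, hinv, hsum⟩ := exists_data m hm z hz1 hzm _ rfl
  set B := C z * PowerSeries.binomialSeries ℂ (1 / (m : ℂ)) with hB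
  set f := X * (B - 1)⁻¹ with hf
  have hf0 : constantCoeff f = 0 := by simp [hf]
  have hf1 : IsUnit (coeff 1 f) := by
    have e : coeff 1 f = constantCoeff (B - 1)⁻¹ := by
      rw [hf, ← coeff_zero_eq_constantCoeff_apply]
      exact coeff_succ_X_mul 0 (B - 1)⁻¹
    rw [e]
    have := congrArg constantCoeff hinv
    rw [map_mul, map_one] at this
    exact IsUnit.of_mul_eq_one_right _ this
  have hs := HasSubst.substInvOfIsUnit f hf1
  have h0 := constantCoeff_substInvOfIsUnit f hf1
  have hr := subst_substInvOfIsUnit_right f hf0 hf1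
  set g := f.substInvOfIsUnit hf1
  refine ⟨B.subst g, ?_, ?_⟩
  · have h := constantCoeff_subst_eq_zero (a := g) h0 (B - C z) (by simp [hB0])
    rw [subst_sub hs, subst_C] at h
    have h2 : constantCoeff (B.subst g - C z) = 0 := h
    rw [map_sub, sub_eq_zero] at h2
    simpa using h2
  · rw [← hr, ← hsum, ← coe_substAlgHom hs, map_sum]
    simp only [map_pow]

lemma formula (m : ℕ) (hm : 2 ≤ m) (z : ℂ) (hz1 : z ≠ 1) (hzm : z ^ m = 1)
    (F : PowerSeries ℂ) (hF0 : constantCoeff F = z)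
    (hF : ∑ j ∈ Finset.range m, F ^ j = X) (l : ℕ) :
    coeff l F = z * ∑ j ∈ Finset.range (l + 1),
      ((-z) ^ j / (((j + 1).factorial : ℂ) * ((l - j).factorial : ℂ))) *
        ∏ i ∈ Finset.range l, (-(((j : ℂ) + 1) / (m : ℂ)) + (i : ℂ)) := by
  rcases l with _ | n
  · simp [hF0]
  have hz : z ≠ 0 := by
    rintro rfl
    rw [zero_pow (by omega)] at hzm
    exact zero_ne_one hzm
  obtain ⟨hB0, hinv, hsum⟩ := exists_data m hm z hz1 hzm _ rfl
  set B := C z * PowerSeries.binomialSeries ℂ (1 / (m : ℂ)) with hB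
  have hf0 : constantCoeff (X * (B - 1)⁻¹) = 0 := by simp
  have hs : HasSubst (X * (B - 1)⁻¹) := HasSubst.of_constantCoeff_zero' hf0
  have hFB : F.subst (X * (B - 1)⁻¹) = B := by
    refine uniq m hm z hz _ _ _ hf0 ?_ hB0 ?_ hsum
    · have h := constantCoeff_subst_eq_zero (a := X * (B - 1)⁻¹) hf0 (F - C z) (by simp [hF0])
      rw [subst_sub hs, subst_C] at h
      have h2 : constantCoeff (F.subst (X * (B - 1)⁻¹) - C z) = 0 := h
      rw [map_sub, sub_eq_zero] at h2
      simpa using h2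
    · have := congrArg (substAlgHom (R := ℂ) hs) hF
      rw [map_sum, substAlgHom_X] at this
      simpa only [map_pow, coe_substAlgHom] using this
  rw [lagrange (B - 1) (B - 1)⁻¹ F hinv n, hFB]
  set φ := B - 1 with hφ
  have e1 : B * (φ ^ n * (φ - X * d⁄dX ℂ φ)) =
      φ ^ (n + 1) * (φ - X * d⁄dX ℂ φ) + φ ^ n * (φ - X * d⁄dX ℂ φ) := by
    rw [hφ]; ring
  rw [e1, map_add, coeff_key, add_zero]
  have e2 : ((n : ℂ) + 2) * coeff (n + 1) (φ ^ (n + 1) * (φ - X * d⁄dX ℂ φ)) =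
      coeff (n + 1) (φ ^ (n + 2)) := by
    have h := congrArg (coeff n) (derivative_pow φ (n + 2))
    rw [coeff_derivative] at h
    have e : φ ^ (n + 1) * (φ - X * d⁄dX ℂ φ) =
        φ ^ (n + 2) - X * (φ ^ (n + 1) * d⁄dX ℂ φ) := by ring
    rw [e, map_sub, coeff_succ_X_mul]
    simp only [mul_assoc, show n + 2 - 1 = n + 1 from rfl] at h
    have h2 : coeff n (((n + 2 : ℕ) : PowerSeries ℂ) * (φ ^ (n + 1) * d⁄dX ℂ φ))
        = ((n : ℂ) + 2) * coeff n (φ ^ (n + 1) * d⁄dX ℂ φ) := by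
      rw [← nsmul_eq_mul, map_nsmul, nsmul_eq_mul]; push_cast; ring
    rw [h2] at h
    linear_combination h
  have hn2 : (n : ℂ) + 2 ≠ 0 := by exact_mod_cast (by omega : n + 2 ≠ 0)
  apply mul_left_cancel₀ hn2
  rw [e2, hφ, sub_eq_add_neg, add_pow, map_sum, Finset.sum_range_succ', Finset.mul_sum,
    Finset.mul_sum]
  have e3 : ∀ k, coeff (n + 1) (B ^ k * (-1) ^ (n + 2 - k) *
      ((n + 2).choose k : PowerSeries ℂ)) =
      z ^ k * (-1) ^ (n + 2 - k) * ((n + 2).choose k : ℂ) * Ring.choose ((k : ℂ) * (1 / m)) (n + 1) := by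
    intro k
    have : B ^ k * (-1) ^ (n + 2 - k) * ((n + 2).choose k : PowerSeries ℂ) =
        C (z ^ k * (-1) ^ (n + 2 - k) * ((n + 2).choose k : ℂ)) *
          PowerSeries.binomialSeries ℂ ((k : ℂ) * (1 / m)) := by
      rw [← binom_pow, hB]
      simp only [map_mul, map_pow, map_neg, map_one, map_natCast]
      ring
    rw [this, coeff_C_mul, binomialSeries_coeff]
    simp
  have e4 : coeff (n + 1) (B ^ 0 * (-1) ^ (n + 2 - 0) *
      ((n + 2).choose 0 : PowerSeries ℂ)) = 0 := by
    rw [e3]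
    simp [Ring.choose_zero_succ]
  rw [e4, add_zero]
  refine Finset.sum_congr rfl fun j hj => ?_
  have hj' : j ≤ n + 1 := Nat.lt_succ_iff.mp (Finset.mem_range.mp hj)
  rw [e3, choose_prod]
  obtain ⟨d, hd⟩ := Nat.exists_eq_add_of_le hj'
  have hsub1 : n + 2 - (j + 1) = d := by omega
  have hsub2 : n + 1 - j = d := by omega
  rw [hsub1, hsub2]
  have hch := Nat.choose_mul_factorial_mul_factorial (show j + 1 ≤ n + 2 by omega)
  rw [hsub1] at hch
  have hch' : ((n + 2).choose (j + 1) : ℂ) * ((j + 1).factorial : ℂ) * (d.factorial : ℂ) =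
      ((n : ℂ) + 2) * ((n + 1).factorial : ℂ) := by
    have := hch.trans (Nat.factorial_succ (n + 1))
    have h := congrArg (Nat.cast : ℕ → ℂ) this
    push_cast at h ⊢
    linear_combination h
  have hp : ∏ i ∈ Finset.range (n + 1), (-(((j + 1 : ℕ) : ℂ) * (1 / (m : ℂ))) + (i : ℂ)) =
      ∏ i ∈ Finset.range (n + 1), (-(((j : ℂ) + 1) / (m : ℂ)) + (i : ℂ)) :=
    Finset.prod_congr rfl fun i _ => by push_cast; ring
  rw [hp]
  have f1 : ((n + 1).factorial : ℂ) ≠ 0 := by exact_mod_cast (n + 1).factorial_ne_zero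
  have f2 : ((j + 1).factorial : ℂ) ≠ 0 := by exact_mod_cast (j + 1).factorial_ne_zero
  have f3 : (d.factorial : ℂ) ≠ 0 := by exact_mod_cast d.factorial_ne_zero
  have hsgn : (-1 : ℂ) ^ d * (-1) ^ (n + 1) = (-1) ^ j := by
    rw [hd, ← pow_add, show d + (j + d) = j + 2 * d by ring, pow_add, pow_mul]; simp
  rw [neg_pow z j, ← hsgn]
  generalize ∏ i ∈ Finset.range (n + 1), (-(((j : ℂ) + 1) / (m : ℂ)) + (i : ℂ)) = P
  rw [div_mul_eq_mul_div, mul_div_assoc', mul_div_assoc', mul_div_assoc',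
    div_eq_div_iff f1 (mul_ne_zero f2 f3)]
  linear_combination (z ^ (j + 1) * (-1) ^ d * (-1) ^ (n + 1) * P) * hch'

end Stmt18Aux



/-- Remark A.5 of the paper:  for `m ≥ 2` there is a unique formal power series `F ∈ ℂ[[t]]`
with constant coefficient `ζ_m = e^{2πi/m}` satisfying `Σ_{j=0}^{m−1} F^j = t`
(i.e. `[m]_{F} = t`), and its coefficients are given by
`coeff l F = ζ_m Σ_{j=0}^{l} ((−ζ_m)^j / ((j+1)!(l−j)!)) (−(j+1)/m)_l`
where `(a)_l = a(a+1)⋯(a+l−1)` is the rising factorial. -/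
theorem stmt18 (m : ℕ) (hm : 2 ≤ m) :
    (∃! F : PowerSeries ℂ,
        PowerSeries.constantCoeff F = Complex.exp (2 * Real.pi * Complex.I / m) ∧
          ∑ j ∈ Finset.range m, F ^ j = PowerSeries.X) ∧
      ∀ F : PowerSeries ℂ,
        PowerSeries.constantCoeff F = Complex.exp (2 * Real.pi * Complex.I / m) →
        (∑ j ∈ Finset.range m, F ^ j = PowerSeries.X) →
        ∀ l : ℕ,
          PowerSeries.coeff l F =
            Complex.exp (2 * Real.pi * Complex.I / m) *
              ∑ j ∈ Finset.range (l + 1),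
                ((-Complex.exp (2 * Real.pi * Complex.I / m)) ^ j /
                    (((j + 1).factorial : ℂ) * ((l - j).factorial : ℂ))) *
                  ∏ i ∈ Finset.range l, (-(((j : ℂ) + 1) / (m : ℂ)) + (i : ℂ)) := by
  have hprim := Complex.isPrimitiveRoot_exp m (by omega)
  have hz1 := hprim.ne_one (by omega)
  have hzm := hprim.pow_eq_one
  have hz := hprim.ne_zero (by omega)
  refine ⟨?_, fun F h0 h l => Stmt18Aux.formula m hm _ hz1 hzm F h0 h l⟩
  obtain ⟨F, h0, h⟩ := Stmt18Aux.existence m hm _ hz1 hzm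
  refine ⟨F, ⟨h0, h⟩, fun G hG => ?_⟩
  exact Stmt18Aux.uniq m hm _ hz PowerSeries.X _ _ (by simp) hG.1 h0 hG.2 h
end

section
/- For each integer m ≥ 2 let F_m ∈ ℂ[[t]] be the unique formal power series with constant coefficient e^{2πi/m} satisfying Σ_{j=0}^{m−1} F_m^j = t, and write c_l(m) for the coefficient of t^l in F_m. Then: (i) the limit as m → ∞ of m·(1 − c_0(m))/(−2πi) is 1; and (ii) for every l ≥ 1 there exists a constant C_l > 0 such that |c_l(m)| ≤ C_l · m^{−l−1} for all integers m ≥ 2. Equivalently, writing 1 − F_m = (−2πi/m) · Σ_{l ≥ 0} α_l(m) t^l, one has α_0(m) = 1 + O(1/m) and, for each fixed l ≥ 1, α_l(m) = O(m^{−l}) as m → ∞. -/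
open Finset

lemma ode_aux (F : PowerSeries ℂ) (m : ℕ) (hm : 2 ≤ m)
    (h : ∑ j ∈ Finset.range m, F ^ j = PowerSeries.X) (G : PowerSeries ℂ) (hG : G = F - 1) :
    (m : PowerSeries ℂ) * PowerSeries.derivative ℂ G =
      G * G + G + PowerSeries.X * PowerSeries.derivative ℂ G
       - ((m : PowerSeries ℂ) - 1) * ((PowerSeries.X * PowerSeries.derivative ℂ G) * G) := by
  have h1 : F ^ m - 1 = PowerSeries.X * (F - 1) := by
    rw [← h, geom_sum_mul]
  have h2 := congrArg (PowerSeries.derivative ℂ) h1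
  rw [map_sub, Derivation.leibniz_pow, Derivation.leibniz, map_sub, Derivation.map_one_eq_zero,
    PowerSeries.derivative_X] at h2
  simp only [nsmul_eq_mul, smul_eq_mul, sub_zero, mul_one] at h2
  have h3 : F ^ (m - 1) * F = F ^ m := by
    rw [← pow_succ]; congr 1; omega
  have h4 : PowerSeries.derivative ℂ G = PowerSeries.derivative ℂ F := by
    rw [hG, map_sub, Derivation.map_one_eq_zero, sub_zero]
  rw [h4, hG]
  linear_combination F * h2 - m * (PowerSeries.derivative ℂ F) * h3 - m * (PowerSeries.derivative ℂ F) * h1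

lemma coeff_X_der (G : PowerSeries ℂ) (l : ℕ) :
    PowerSeries.coeff l (PowerSeries.X * PowerSeries.derivative ℂ G)
      = l * PowerSeries.coeff l G := by
  cases l with
  | zero => simp
  | succ n => rw [PowerSeries.coeff_succ_X_mul, PowerSeries.coeff_derivative]; push_cast; ring

lemma coeff_rec (G : PowerSeries ℂ) (m : ℕ)
    (h : (m : PowerSeries ℂ) * PowerSeries.derivative ℂ G =
      G * G + G + PowerSeries.X * PowerSeries.derivative ℂ G
       - ((m : PowerSeries ℂ) - 1) * ((PowerSeries.X * PowerSeries.derivative ℂ G) * G)) (l : ℕ) :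
    (m : ℂ) * ((l + 1) * PowerSeries.coeff (l + 1) G) =
      (l + 1) * PowerSeries.coeff l G + ∑ p ∈ antidiagonal l,
        (1 - ((m : ℂ) - 1) * p.1) * (PowerSeries.coeff p.1 G * PowerSeries.coeff p.2 G) := by
  have hc : (m : PowerSeries ℂ) = PowerSeries.C (m : ℂ) := by simp
  have hc1 : (m : PowerSeries ℂ) - 1 = PowerSeries.C ((m : ℂ) - 1) := by simp
  rw [hc1, hc] at h
  have h' := congrArg (PowerSeries.coeff l) h
  rw [map_sub, map_add, map_add, PowerSeries.coeff_C_mul, PowerSeries.coeff_C_mul, coeff_X_der,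
    PowerSeries.coeff_mul, PowerSeries.coeff_mul, PowerSeries.coeff_derivative] at h'
  simp only [coeff_X_der] at h'
  have : ∑ p ∈ antidiagonal l,
        (1 - ((m : ℂ) - 1) * p.1) * (PowerSeries.coeff p.1 G * PowerSeries.coeff p.2 G)
      = ∑ p ∈ antidiagonal l, PowerSeries.coeff p.1 G * PowerSeries.coeff p.2 G
       - ((m : ℂ) - 1) * ∑ p ∈ antidiagonal l,
          p.1 * PowerSeries.coeff p.1 G * PowerSeries.coeff p.2 G := by
    rw [Finset.mul_sum, ← Finset.sum_sub_distrib]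
    exact Finset.sum_congr rfl fun p _ => by ring
  rw [this]
  linear_combination h'

lemma bound_aux (G : ℕ → PowerSeries ℂ)
    (h0 : ∀ m : ℕ, 2 ≤ m → ‖PowerSeries.coeff 0 (G m)‖ ≤ 2 * Real.pi / m)
    (h : ∀ m : ℕ, 2 ≤ m → ∀ l : ℕ, (m : ℂ) * ((l + 1) * PowerSeries.coeff (l + 1) (G m)) =
      (l + 1) * PowerSeries.coeff l (G m) + ∑ p ∈ antidiagonal l,
        (1 - ((m : ℂ) - 1) * p.1) * (PowerSeries.coeff p.1 (G m) * PowerSeries.coeff p.2 (G m)))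
    (l : ℕ) : ∃ C : ℝ, 0 < C ∧ ∀ m : ℕ, 2 ≤ m →
        ‖PowerSeries.coeff l (G m)‖ ≤ C / (m : ℝ) ^ (l + 1) := by
  induction l using Nat.strong_induction_on with
  | _ l ih =>
  cases l with
  | zero => exact ⟨2 * Real.pi, by positivity, fun m hm => by simpa using h0 m hm⟩
  | succ l =>
  have ih' : ∀ k : ℕ, ∃ C : ℝ, 0 < C ∧ (k ≤ l → ∀ m : ℕ, 2 ≤ m →
        ‖PowerSeries.coeff k (G m)‖ ≤ C / (m : ℝ) ^ (k + 1)) := by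
    intro k
    by_cases hk : k ≤ l
    · obtain ⟨C, hC, hb⟩ := ih k (by omega)
      exact ⟨C, hC, fun _ => hb⟩
    · exact ⟨1, one_pos, fun h => absurd h hk⟩
  choose C hC hb using ih'
  refine ⟨(l + 1) * C l + ∑ p ∈ antidiagonal l, (1 + p.1) * (C p.1 * C p.2), ?_, ?_⟩
  · have := hC l
    have : 0 ≤ ∑ p ∈ antidiagonal l, (1 + (p.1 : ℝ)) * (C p.1 * C p.2) :=
      Finset.sum_nonneg fun p _ => by have := hC p.1; have := hC p.2; positivity
    positivity
  intro m hm
  have hm1 : (1 : ℝ) ≤ m := by exact_mod_cast (by omega : 1 ≤ m)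
  have hm0 : (0 : ℝ) < m := by linarith
  have key : ‖(l + 1) * PowerSeries.coeff l (G m) + ∑ p ∈ antidiagonal l,
        (1 - ((m : ℂ) - 1) * p.1) * (PowerSeries.coeff p.1 (G m) * PowerSeries.coeff p.2 (G m))‖
      ≤ ((l + 1) * C l + ∑ p ∈ antidiagonal l, (1 + p.1) * (C p.1 * C p.2)) / (m : ℝ) ^ (l + 1) := by
    rw [add_div, Finset.sum_div]
    refine (norm_add_le _ _).trans (add_le_add ?_ ((norm_sum_le _ _).trans
      (Finset.sum_le_sum ?_)))
    · rw [norm_mul, mul_div_assoc]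
      have : ‖(l + 1 : ℂ)‖ = l + 1 := by
        exact_mod_cast Complex.norm_natCast (l + 1)
      rw [this]
      exact mul_le_mul_of_nonneg_left (hb l le_rfl m hm) (by positivity)
    · intro p hp
      have hpl : p.1 + p.2 = l := by simpa using hp
      have e1 := hb p.1 (by omega) m hm
      have e2 := hb p.2 (by omega) m hm
      have e3 : ‖1 - ((m : ℂ) - 1) * p.1‖ ≤ m * (1 + p.1) := by
        refine (norm_sub_le _ _).trans ?_
        have : ‖(m : ℂ) - 1‖ = m - 1 := by
          have := Complex.norm_of_nonneg (r := (m : ℝ) - 1) (by linarith)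
          push_cast at this
          exact this
        rw [norm_mul, this, norm_one, Complex.norm_natCast]
        have : (0 : ℝ) ≤ p.1 := by positivity
        nlinarith
      have c1 := hC p.1
      have c2 := hC p.2
      rw [norm_mul, norm_mul]
      calc _ ≤ (m * (1 + p.1)) * ((C p.1 / (m : ℝ) ^ (p.1 + 1)) * (C p.2 / (m : ℝ) ^ (p.2 + 1))) := by
            gcongr
        _ = _ := by
            rw [← hpl]
            field_simp
            ring
  rw [← h m hm l, norm_mul, norm_mul, Complex.norm_natCast] at key
  have : ‖(l + 1 : ℂ)‖ = l + 1 := by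
    exact_mod_cast Complex.norm_natCast (l + 1)
  rw [this] at key
  rw [pow_succ, ← div_div, le_div_iff₀ hm0]
  refine le_trans ?_ key
  have a1 : (0 : ℝ) ≤ l := by positivity
  have a2 : 0 ≤ ‖PowerSeries.coeff (l + 1) (G m)‖ := norm_nonneg _
  have a3 : 0 ≤ (m : ℝ) * (l * ‖PowerSeries.coeff (l + 1) (G m)‖) := by positivity
  linarith

/-- Proposition A.2 of the paper.  For `m ≥ 2` let `F m ∈ ℂ[[t]]` be the unique power series
with constant coefficient `e^{2πi/m}` satisfying `Σ_{j=0}^{m−1} (F m)^j = t`, and write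
`c_l(m)` for its `t^l`-coefficient.  Then
(i) `m (1 − c_0(m))/(−2πi) → 1` as `m → ∞`, and
(ii) for every `l ≥ 1` there is `C_l > 0` with `|c_l(m)| ≤ C_l m^{−l−1}` for all `m ≥ 2`.
(Equivalently, writing `1 − F_m = (−2πi/m) Σ_{l≥0} α_l(m) t^l`, one has
`α_0(m) = 1 + O(1/m)` and `α_l(m) = O(m^{−l})` for each fixed `l ≥ 1`.) -/
theorem stmt19 (F : ℕ → PowerSeries ℂ)
    (hF : ∀ m : ℕ, 2 ≤ m →
      PowerSeries.constantCoeff (F m) = Complex.exp (2 * Real.pi * Complex.I / m) ∧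
        ∑ j ∈ Finset.range m, (F m) ^ j = PowerSeries.X) :
    Filter.Tendsto
        (fun m : ℕ =>
          (m : ℂ) * (1 - PowerSeries.coeff 0 (F m)) / (-(2 * Real.pi * Complex.I)))
        Filter.atTop (nhds 1) ∧
      ∀ l : ℕ, 1 ≤ l → ∃ C : ℝ, 0 < C ∧ ∀ m : ℕ, 2 ≤ m →
        ‖PowerSeries.coeff l (F m)‖ ≤ C / (m : ℝ) ^ (l + 1) := by
  constructor
  · have hc : (2 * Real.pi * Complex.I : ℂ) ≠ 0 := Complex.two_pi_I_ne_zero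
    set c : ℂ := 2 * Real.pi * Complex.I with hcd
    have hd := (hasDerivAt_iff_tendsto_slope.1 (Complex.hasDerivAt_exp 0))
    have ht : Filter.Tendsto (fun m : ℕ => c / (m : ℂ)) Filter.atTop (nhdsWithin 0 {0}ᶜ) := by
      refine tendsto_nhdsWithin_iff.2 ⟨tendsto_const_div_atTop_nhds_zero_nat c, ?_⟩
      filter_upwards [Filter.eventually_ge_atTop 1] with m hm
      have : (m : ℂ) ≠ 0 := by exact_mod_cast (by omega : m ≠ 0)
      exact div_ne_zero hc this
    have := hd.comp ht
    rw [Complex.exp_zero] at this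
    refine this.congr' ?_
    filter_upwards [Filter.eventually_ge_atTop 2] with m hm
    have hm0 : (m : ℂ) ≠ 0 := by exact_mod_cast (by omega : m ≠ 0)
    rw [PowerSeries.coeff_zero_eq_constantCoeff_apply, (hF m hm).1]
    simp only [Function.comp, slope_def_field, Complex.exp_zero, sub_zero]
    field_simp
    ring
  · intro l hl
    have h0 : ∀ m : ℕ, 2 ≤ m → ‖PowerSeries.coeff 0 (F m - 1)‖ ≤ 2 * Real.pi / m := by
      intro m hm
      have := Real.norm_exp_I_mul_ofReal_sub_one_le (x := 2 * Real.pi / m)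
      rw [map_sub, PowerSeries.coeff_zero_eq_constantCoeff_apply, (hF m hm).1]
      have e : (2 * Real.pi * Complex.I / m : ℂ) = Complex.I * ((2 * Real.pi / m : ℝ) : ℂ) := by
        push_cast; ring
      rw [e]
      have e2 : ‖(2 * Real.pi / m : ℝ)‖ = 2 * Real.pi / m :=
        Real.norm_of_nonneg (by positivity)
      rw [e2] at this
      simpa using this
    obtain ⟨C, hC, hb⟩ := bound_aux (fun m => F m - 1) h0
      (fun m hm => coeff_rec _ m (ode_aux (F m) m hm (hF m hm).2 _ rfl)) l
    refine ⟨C, hC, fun m hm => ?_⟩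
    have := hb m hm
    rwa [map_sub, PowerSeries.coeff_one, if_neg (by omega), sub_zero] at this
end
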